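/- Let R be a commutative ring and r, s, r', s' ∈ R. If the free quadratic R-algebras C(r,s) and C(r',s') are isomorphic as R-algebras, then there exists a unit ε of R such that r'² − 4s' = ε²·(r² − 4s) and r' − ε·r ∈ 2R. -/

import Mathlib

open Polynomial

/-- The free quadratic `R`-algebra `R[x]/(x² + r·x + s)`. -/
noncomputable abbrev QuadAlg (R : Type*) [CommRing R] (r s : R) :=
  AdjoinRoot (X ^ 2 + C r * X + C s)

theorem quad_monic (R : Type*) [CommRing R] (r s : R) :
    (X ^ 2 + C r * X + C s : R[X]).Monic := by
  monicity!

theorem quad_span (R : Type*) [CommRing R] [Nontrivial R] (r s : R) (z : QuadAlg R r s) :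
    ∃ a b : R, z = algebraMap R _ a + algebraMap R _ b * AdjoinRoot.root _ := by
  obtain ⟨f, rfl⟩ := AdjoinRoot.mk_surjective z
  have hm := quad_monic R r s
  have hd : (X ^ 2 + C r * X + C s : R[X]).degree = 2 := by compute_degree!
  have h1 : (f %ₘ (X ^ 2 + C r * X + C s)).degree ≤ 1 := by
    have := degree_modByMonic_lt f hm
    rw [hd] at this
    exact Order.le_of_lt_succ this
  obtain ⟨b, a, h⟩ : ∃ b a : R, f %ₘ (X ^ 2 + C r * X + C s) = C b * X + C a :=
    ⟨_, _, eq_X_add_C_of_degree_le_one h1⟩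
  refine ⟨a, b, ?_⟩
  have h2 := AdjoinRoot.mk_leftInverse hm (AdjoinRoot.mk _ f)
  rw [AdjoinRoot.modByMonicHom_mk, h] at h2
  rw [← h2]
  simp [AdjoinRoot.algebraMap_eq, add_comm]

theorem quad_indep (R : Type*) [CommRing R] [Nontrivial R] (r s a b : R)
    (h : algebraMap R (QuadAlg R r s) a + algebraMap R _ b * AdjoinRoot.root _ = 0) :
    a = 0 ∧ b = 0 := by
  have hm := quad_monic R r s
  have hd : (X ^ 2 + C r * X + C s : R[X]).degree = 2 := by compute_degree!
  have h1 : AdjoinRoot.mk (X ^ 2 + C r * X + C s) (C b * X + C a) = 0 := by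
    rw [← h]; simp [AdjoinRoot.algebraMap_eq, add_comm]
  rw [AdjoinRoot.mk_eq_zero] at h1
  have h2 : C b * X + C a = 0 := by
    by_contra hne
    refine hm.not_dvd_of_degree_lt hne ?_ h1
    rw [hd]
    exact lt_of_le_of_lt degree_linear_le (by norm_num)
  constructor
  · simpa using congrArg (fun p => coeff p 0) h2
  · simpa using congrArg (fun p => coeff p 1) h2

theorem quad_root (R : Type*) [CommRing R] (r s : R) :
    (AdjoinRoot.root _ : QuadAlg R r s) ^ 2 + algebraMap R _ r * AdjoinRoot.root _
      + algebraMap R _ s = 0 := by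
  have := AdjoinRoot.mk_self (f := X ^ 2 + C r * X + C s)
  rw [← this]
  simp only [AdjoinRoot.algebraMap_eq, map_add, map_mul, map_pow, AdjoinRoot.mk_X, AdjoinRoot.mk_C]

/-- If the free quadratic `R`-algebras `C(r,s)` and `C(r',s')` are
isomorphic as `R`-algebras, then there is a unit `ε` of `R` with
`r'² − 4s' = ε² · (r² − 4s)` and `r' − ε·r ∈ 2R`. -/
theorem type_isomorphism_invariant
    (R : Type*) [CommRing R] (r s r' s' : R)
    (h : Nonempty (QuadAlg R r s ≃ₐ[R] QuadAlg R r' s')) :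
    ∃ ε : Rˣ, r' ^ 2 - 4 * s' = (ε : R) ^ 2 * (r ^ 2 - 4 * s) ∧
      r' - (ε : R) * r ∈ Ideal.span ({2} : Set R) := by
  obtain ⟨e⟩ := h
  cases subsingleton_or_nontrivial R with
  | inl hs =>
    refine ⟨1, Subsingleton.elim _ _, ?_⟩
    rw [Subsingleton.elim (r' - _) 0]
    exact Ideal.zero_mem _
  | inr hn =>
    obtain ⟨c, d, hcd⟩ := quad_span R r' s' (e (AdjoinRoot.root _))
    obtain ⟨a, b, hab⟩ := quad_span R r s (e.symm (AdjoinRoot.root _))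
    have hy := quad_root R r' s'
    have hx := congrArg e (quad_root R r s)
    have hab2 := congrArg e hab
    simp only [map_add, map_mul, map_pow, AlgEquiv.commutes, map_zero,
      AlgEquiv.apply_symm_apply, hcd] at hx hab2
    generalize hY : (AdjoinRoot.root _ : QuadAlg R r' s') = y at *
    have k1 := quad_indep R r' s' (a + b * c) (b * d - 1) (by
      rw [hY]; simp only [map_add, map_mul, map_sub, map_one]
      linear_combination -hab2)
    have k2 := quad_indep R r' s' (c ^ 2 - d ^ 2 * s' + r * c + s)
      (2 * c * d - d ^ 2 * r' + r * d) (by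
      rw [hY]; simp only [map_add, map_mul, map_sub, map_pow, map_ofNat]
      linear_combination hx - (algebraMap R _ d) ^ 2 * hy)
    obtain ⟨-, hbd⟩ := k1
    obtain ⟨k3, k4⟩ := k2
    have hbd' : b * d = 1 := by linear_combination hbd
    have hr : r' = b * (2 * c + r) := by
      linear_combination (-b ^ 2) * k4 + (b * (2 * c + r) - (b * d + 1) * r') * hbd'
    have hs : s' = b ^ 2 * (c ^ 2 + r * c + s) := by
      linear_combination (-b ^ 2) * k3 - (b * d + 1) * s' * hbd'
    refine ⟨⟨b, d, hbd', by rw [mul_comm]; exact hbd'⟩, ?_, ?_⟩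
    · rw [hr, hs]; ring
    · rw [Ideal.mem_span_singleton]
      exact ⟨b * c, by simp only; rw [hr]; ring⟩
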